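/- arXiv:2012.03120 — 3 statements merged into one kernel-verified Lean document; each statement's English description precedes it below -/
import Mathlib

section
/- The set of real numbers δ in the interval [1/4, 3/2] such that for every q in the closed interval [1 − δ/3, 2 − δ] the polynomial s^3 + (2 − |q − δ|)·s^2 + 2·s + 3 is Hurwitz equals the open interval (3/4, 9/8). -/
open Polynomial

/-- A polynomial over `ℂ` is Hurwitz if all its roots have negative real part. -/
def IsHurwitz (P : Polynomial ℂ) : Prop := ∀ z : ℂ, P.IsRoot z → z.re < 0

/-- The characteristic polynomial `s^3 + (2 - |q - δ|) s^2 + 2 s + 3` from Example 3. -/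
noncomputable def examplePoly (q δ : ℝ) : Polynomial ℂ :=
  X ^ 3 + C ((2 - |q - δ| : ℝ) : ℂ) * X ^ 2 + C 2 * X + C 3

theorem exists_root_re_nonneg_of_le {a : ℝ} (ha : a ≤ 3 / 2) :
    ∃ z : ℂ, z ^ 3 + (a : ℂ) * z ^ 2 + 2 * z + 3 = 0 ∧ 0 ≤ z.re := by
  obtain ⟨r, ⟨-, hra⟩, hr⟩ : ∃ r ∈ Set.Icc (-|a| - 5) (-a), r ^ 3 + a * r ^ 2 + 2 * r + 3 = 0 := by
    have hle := le_abs_self a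
    have hnonneg := abs_nonneg a
    refine intermediate_value_Icc (f := fun r : ℝ => r ^ 3 + a * r ^ 2 + 2 * r + 3)
      (by linarith) (by fun_prop) ⟨?_, ?_⟩
    · have h : 0 ≤ (-|a| - 5) ^ 2 * (|a| + 5 - a) :=
        mul_nonneg (sq_nonneg _) (by linarith)
      linear_combination h + 2 * hnonneg
    · linear_combination 2 * ha
  have hr' : (r : ℂ) ^ 3 + a * r ^ 2 + 2 * r + 3 = 0 := by exact_mod_cast hr
  obtain ⟨w, hw, hw0⟩ : ∃ w : ℂ,
      ((a : ℂ) + r) ^ 2 - 4 * (2 + r * (a + r)) = w * w ∧ 0 ≤ w.re := by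
    obtain ⟨w, hw⟩ := IsAlgClosed.exists_eq_mul_self
      (((a : ℂ) + r) ^ 2 - 4 * (2 + r * (a + r)))
    rcases le_total 0 w.re with h | h
    · exact ⟨w, hw, h⟩
    · exact ⟨-w, by rw [hw]; ring, by simpa using h⟩
  refine ⟨((-(a + r) / 2 : ℝ) : ℂ) + ((1 / 2 : ℝ) : ℂ) * w, ?_, ?_⟩
  · push_cast
    linear_combination hr' - ((-((a : ℂ) + r) + w) / 2 - r) / 4 * hw
  · rw [Complex.add_re, Complex.re_ofReal_mul, Complex.ofReal_re]
    linarith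

theorem re_neg_of_root {a : ℝ} (ha : 3 / 2 < a) {z : ℂ}
    (hz : z ^ 3 + (a : ℂ) * z ^ 2 + 2 * z + 3 = 0) : z.re < 0 := by
  obtain ⟨x, y⟩ := z
  have hre := congrArg Complex.re hz
  have him := congrArg Complex.im hz
  simp [pow_succ] at hre him
  change x < 0
  by_contra! hx
  have hax : 0 ≤ a * x ^ 2 := by positivity
  have hx3 : 0 ≤ x ^ 3 := by positivity
  have hprod : y * (3 * x ^ 2 - y ^ 2 + 2 * a * x + 2) = 0 := by linear_combination him
  rcases mul_eq_zero.mp hprod with hy | hy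
  · subst hy
    linarith
  · have hax' : 0 ≤ a ^ 2 * x := by positivity
    have hsum : 8 * x ^ 3 + 8 * (a * x ^ 2) + 4 * x + 2 * (a ^ 2 * x) + 2 * a - 3 = 0 := by
      linear_combination (3 * x + a) * hy - hre
    linarith

theorem isHurwitz_examplePoly_iff (q δ : ℝ) :
    IsHurwitz (examplePoly q δ) ↔ |q - δ| < 1 / 2 := by
  have hroot (z : ℂ) : (examplePoly q δ).IsRoot z ↔
      z ^ 3 + ((2 - |q - δ| : ℝ) : ℂ) * z ^ 2 + 2 * z + 3 = 0 := by
    simp only [examplePoly, IsRoot.def, eval_add, eval_mul, eval_pow, eval_X, eval_C]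
  constructor
  · intro h
    by_contra! hq
    obtain ⟨z, hz, hz0⟩ := exists_root_re_nonneg_of_le (a := 2 - |q - δ|) (by linarith)
    exact (h z ((hroot z).mpr hz)).not_ge hz0
  · intro hq z hz
    exact re_neg_of_root (by linarith) ((hroot z).mp hz)

theorem robustly_stable_set_dependent_eq :
    {δ : ℝ | δ ∈ Set.Icc (1 / 4 : ℝ) (3 / 2) ∧
        ∀ q ∈ Set.Icc (1 - δ / 3) (2 - δ), IsHurwitz (examplePoly q δ)} =
      Set.Ioo (3 / 4 : ℝ) (9 / 8) := by
  ext δ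
  simp only [isHurwitz_examplePoly_iff, Set.mem_ofPred_eq, Set.mem_Icc, Set.mem_Ioo, abs_lt]
  constructor
  · rintro ⟨⟨-, h⟩, hq⟩
    have hleft := hq (1 - δ / 3) ⟨le_rfl, by linarith⟩
    have hright := hq (2 - δ) ⟨by linarith, le_rfl⟩
    constructor <;> linarith
  · rintro ⟨h, h'⟩
    refine ⟨⟨by linarith, by linarith⟩, fun q hq => ⟨?_, ?_⟩⟩ <;> linarith [hq.1, hq.2]
end

section
/- Let μ be the uniform probability measure on the interval [1/4, 3/2] (one-dimensional Lebesgue measure restricted to [1/4, 3/2] and normalized by its length 5/4). Then μ of the set {δ ∈ ℝ : for all q ∈ [1 − δ/3, 2 − δ], the polynomial s^3 + (2 − |q − δ|)·s^2 + 2·s + 3 is Hurwitz} equals 3/10. -/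
open Polynomial MeasureTheory

/-- The uniform probability measure on `[1/4, 3/2]`. -/
noncomputable def unifMeasure : Measure ℝ :=
  (5 / 4 : ENNReal)⁻¹ • volume.restrict (Set.Icc (1 / 4 : ℝ) (3 / 2))

theorem examplePoly_isRoot_iff (q δ : ℝ) (z : ℂ) :
    (examplePoly q δ).IsRoot z ↔
      z.re ^ 3 - 3 * z.re * z.im ^ 2 + (2 - |q - δ|) * (z.re ^ 2 - z.im ^ 2) + 2 * z.re + 3 = 0 ∧
      z.im * (3 * z.re ^ 2 - z.im ^ 2 + 2 * (2 - |q - δ|) * z.re + 2) = 0 := by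
  have heval : (examplePoly q δ).eval z =
      z ^ 3 + ((2 - |q - δ| : ℝ) : ℂ) * z ^ 2 + 2 * z + 3 := by
    simp [examplePoly]
  rw [IsRoot.def, heval, Complex.ext_iff]
  generalize 2 - |q - δ| = a
  simp only [pow_succ, pow_zero, one_mul, Complex.add_re, Complex.add_im, Complex.mul_re,
    Complex.mul_im, Complex.ofReal_re, Complex.ofReal_im, Complex.re_ofNat, Complex.im_ofNat,
    Complex.zero_re, Complex.zero_im]
  constructor <;> rintro ⟨h₁, h₂⟩ <;> constructor <;> linarith

theorem isHurwitz_examplePoly_of_abs_lt {q δ : ℝ} (h : |q - δ| < 1 / 2) :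
    IsHurwitz (examplePoly q δ) := by
  intro z hz
  rw [examplePoly_isRoot_iff] at hz
  have ha : 3 / 2 < 2 - |q - δ| := by linarith
  generalize 2 - |q - δ| = a at hz ha
  obtain ⟨hre, him⟩ := hz
  by_contra! hx
  generalize z.re = x at *
  generalize z.im = y at *
  have ha₀ : 0 < a := by linarith
  rcases mul_eq_zero.mp him with rfl | hy
  · have : 0 < x ^ 3 + a * x ^ 2 + 2 * x + 3 := by positivity
    linarith
  · have hy' : y ^ 2 = 3 * x ^ 2 + 2 * a * x + 2 := by linarith
    rw [hy'] at hre
    have : 0 ≤ 8 * x ^ 3 + 8 * a * x ^ 2 + (4 + 2 * a ^ 2) * x := by positivity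
    linarith

theorem not_isHurwitz_examplePoly {q δ : ℝ} (h : 1 / 2 ≤ |q - δ|) (h' : |q - δ| ≤ 2) :
    ¬ IsHurwitz (examplePoly q δ) := by
  intro hH
  have key : ∀ x y : ℝ, _ → x < 0 := fun x y hxy =>
    hH ⟨x, y⟩ ((examplePoly_isRoot_iff q δ ⟨x, y⟩).mpr hxy)
  have ha : 2 - |q - δ| ≤ 3 / 2 := by linarith
  have ha₀ : 0 ≤ 2 - |q - δ| := by linarith
  generalize 2 - |q - δ| = a at key ha ha₀
  obtain ⟨x, ⟨hx, -⟩, hroot⟩ : ∃ x ∈ Set.Icc (0 : ℝ) 1,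
      8 * x ^ 3 + 8 * a * x ^ 2 + (4 + 2 * a ^ 2) * x = 3 - 2 * a := by
    refine intermediate_value_Icc zero_le_one (f := fun x : ℝ =>
      8 * x ^ 3 + 8 * a * x ^ 2 + (4 + 2 * a ^ 2) * x) (by fun_prop) ⟨?_, ?_⟩
    · norm_num
      linarith
    · nlinarith [sq_nonneg a]
  have hs : √(3 * x ^ 2 + 2 * a * x + 2) ^ 2 = 3 * x ^ 2 + 2 * a * x + 2 :=
    Real.sq_sqrt (by positivity)
  refine absurd (key x √(3 * x ^ 2 + 2 * a * x + 2) ⟨?_, ?_⟩) hx.not_gt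
  · simp only [hs]
    linarith
  · simp only [hs]
    ring

theorem forall_isHurwitz_examplePoly_iff {δ : ℝ} (hδ : δ ∈ Set.Icc (1 / 4 : ℝ) (3 / 2)) :
    (∀ q ∈ Set.Icc (1 - δ / 3) (2 - δ), IsHurwitz (examplePoly q δ)) ↔
      δ ∈ Set.Ioo (3 / 4 : ℝ) (9 / 8) := by
  obtain ⟨h₁, h₂⟩ := hδ
  constructor
  · intro h
    constructor
    · by_contra! hle
      have habs : |2 - δ - δ| = 2 - δ - δ := abs_of_nonneg (by linarith)
      exact not_isHurwitz_examplePoly (by linarith) (by linarith)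
        (h (2 - δ) ⟨by linarith, le_rfl⟩)
    · by_contra! hle
      have habs : |1 - δ / 3 - δ| = -(1 - δ / 3 - δ) := abs_of_nonpos (by linarith)
      exact not_isHurwitz_examplePoly (by linarith) (by linarith)
        (h (1 - δ / 3) ⟨le_rfl, by linarith⟩)
  · rintro ⟨h₃, h₄⟩ q ⟨hq₁, hq₂⟩
    exact isHurwitz_examplePoly_of_abs_lt (abs_lt.mpr ⟨by linarith, by linarith⟩)

theorem mixed_robustness_probability_dependent :
    unifMeasure
      {δ : ℝ | ∀ q ∈ Set.Icc (1 - δ / 3) (2 - δ), IsHurwitz (examplePoly q δ)} =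
      3 / 10 := by
  have hset : {δ : ℝ | ∀ q ∈ Set.Icc (1 - δ / 3) (2 - δ), IsHurwitz (examplePoly q δ)} ∩
      Set.Icc (1 / 4 : ℝ) (3 / 2) = Set.Ioo (3 / 4 : ℝ) (9 / 8) := by
    ext δ
    constructor
    · rintro ⟨h, hδ⟩
      exact (forall_isHurwitz_examplePoly_iff hδ).mp h
    · intro h
      have hδ : δ ∈ Set.Icc (1 / 4 : ℝ) (3 / 2) := ⟨by linarith [h.1], by linarith [h.2]⟩
      exact ⟨(forall_isHurwitz_examplePoly_iff hδ).mpr h, hδ⟩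
  have hc : (5 / 4 : ENNReal) = ENNReal.ofReal (5 / 4) := by
    rw [ENNReal.ofReal_div_of_pos (by norm_num)]
    norm_num
  have hr : (3 / 10 : ENNReal) = ENNReal.ofReal (3 / 10) := by
    rw [ENNReal.ofReal_div_of_pos (by norm_num)]
    norm_num
  rw [unifMeasure, Measure.smul_apply, Measure.restrict_apply' measurableSet_Icc, hset,
    Real.volume_Ioo, smul_eq_mul, hc, hr, ← ENNReal.ofReal_inv_of_pos (by norm_num),
    ← ENNReal.ofReal_mul (by norm_num)]
  norm_num
end

section
/- For each real q define p(q) as the measure of the open interval (q − 1/2, q + 1/2) under the Gaussian probability measure on ℝ with mean 1.4 − 0.5·q and variance (q/8)^2. Then for every q in the closed interval [0.7, 1.1], p(q) ≥ p(0.7); that is, the guaranteed probability of stability inf over q ∈ [0.7, 1.1] of p(q) is attained at the worst-case parameter q = 0.7. -/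
open MeasureTheory ProbabilityTheory

/-- The probability of stability `p(q)`: the measure of the interval
`(q - 1/2, q + 1/2)` under the Gaussian measure with mean `1.4 - 0.5 q` and
variance `(q/8)^2`. -/
noncomputable def stabilityProb (q : ℝ) : ENNReal :=
  gaussianReal (1.4 - 0.5 * q) (Real.toNNReal ((q / 8) ^ 2))
    (Set.Ioo (q - 1 / 2) (q + 1 / 2))

lemma gaussianPDFReal_zero_one_le_of_sq_le {x y : ℝ} (h : y ^ 2 ≤ x ^ 2) :
    gaussianPDFReal 0 1 x ≤ gaussianPDFReal 0 1 y := by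
  simp only [gaussianPDFReal, NNReal.coe_one, sub_zero]
  gcongr

lemma gaussianReal_le_mul_volume {s : Set ℝ} (hs : MeasurableSet s) {y : ℝ}
    (h : ∀ x ∈ s, y ^ 2 ≤ x ^ 2) :
    gaussianReal 0 1 s ≤ gaussianPDF 0 1 y * volume s := by
  rw [gaussianReal_apply 0 one_ne_zero, ← setLIntegral_const]
  exact setLIntegral_mono' hs fun x hx =>
    ENNReal.ofReal_le_ofReal (gaussianPDFReal_zero_one_le_of_sq_le (h x hx))

lemma mul_volume_le_gaussianReal {s : Set ℝ} (hs : MeasurableSet s) {y : ℝ}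
    (h : ∀ x ∈ s, x ^ 2 ≤ y ^ 2) :
    gaussianPDF 0 1 y * volume s ≤ gaussianReal 0 1 s := by
  rw [gaussianReal_apply 0 one_ne_zero, ← setLIntegral_const]
  exact setLIntegral_mono' hs fun x hx =>
    ENNReal.ofReal_le_ofReal (gaussianPDFReal_zero_one_le_of_sq_le (h x hx))

/-- Shifting the interval `(c, e)` to the right to `(d, f)` increases its standard Gaussian
measure if the bound `(d - c) φ(d)` on the mass lost is at most the bound `(f - e) φ(f)` on the
mass gained. -/
lemma gaussianReal_Ioo_le_Ioo {c d e f : ℝ} (hcd : c ≤ d) (hd : d ≤ 0) (he : 0 < e) (hef : e ≤ f)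
    (h : (d - c) * Real.exp (-d ^ 2 / 2) ≤ (f - e) * Real.exp (-f ^ 2 / 2)) :
    gaussianReal 0 1 (Set.Ioo c e) ≤ gaussianReal 0 1 (Set.Ioo d f) := by
  have hde : d < e := hd.trans_lt he
  have hlost : gaussianReal 0 1 (Set.Ioc c d) ≤ gaussianReal 0 1 (Set.Ico e f) := by
    calc gaussianReal 0 1 (Set.Ioc c d)
        ≤ gaussianPDF 0 1 d * volume (Set.Ioc c d) :=
          gaussianReal_le_mul_volume measurableSet_Ioc fun x hx => by nlinarith [hx.2]
      _ ≤ gaussianPDF 0 1 f * volume (Set.Ico e f) := by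
          rw [Real.volume_Ioc, Real.volume_Ico, gaussianPDF, gaussianPDF,
            ← ENNReal.ofReal_mul (gaussianPDFReal_nonneg _ _ _),
            ← ENNReal.ofReal_mul (gaussianPDFReal_nonneg _ _ _)]
          refine ENNReal.ofReal_le_ofReal ?_
          simp only [gaussianPDFReal, NNReal.coe_one, sub_zero, mul_one]
          rw [mul_assoc, mul_assoc]
          gcongr ?_ * ?_
          linarith
      _ ≤ gaussianReal 0 1 (Set.Ico e f) :=
          mul_volume_le_gaussianReal measurableSet_Ico fun x hx => by nlinarith [hx.1, hx.2]
  calc gaussianReal 0 1 (Set.Ioo c e)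
      = gaussianReal 0 1 (Set.Ioc c d ∪ Set.Ioo d e) := by
        rw [Set.Ioc_union_Ioo_eq_Ioo hcd hde]
    _ ≤ gaussianReal 0 1 (Set.Ioc c d) + gaussianReal 0 1 (Set.Ioo d e) := measure_union_le _ _
    _ ≤ gaussianReal 0 1 (Set.Ico e f) + gaussianReal 0 1 (Set.Ioo d e) := by gcongr
    _ = gaussianReal 0 1 (Set.Ioo d e ∪ Set.Ico e f) := by
        rw [add_comm, measure_union _ measurableSet_Ico]
        exact Set.disjoint_left.2 fun x hx hx' => absurd hx.2 (not_lt.2 hx'.1)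
    _ = gaussianReal 0 1 (Set.Ioo d f) := by rw [Set.Ioo_union_Ico_eq_Ioo hde hef]

lemma gaussianReal_zero_one_Ioo_neg (a b : ℝ) :
    gaussianReal 0 1 (Set.Ioo (-b) (-a)) = gaussianReal 0 1 (Set.Ioo a b) := by
  have h : (gaussianReal 0 1).map (fun x : ℝ => -x) = gaussianReal 0 1 := by
    rw [gaussianReal_map_neg, neg_zero]
  conv_rhs => rw [← h]
  rw [Measure.map_apply measurable_neg measurableSet_Ioo]
  congr 1
  ext x
  simp only [Set.mem_Ioo, Set.mem_preimage]
  constructor <;> rintro ⟨h₁, h₂⟩ <;> constructor <;> linarith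

lemma stabilityProb_eq_standard {q : ℝ} (hq : 0 < q) :
    stabilityProb q = gaussianReal 0 1 (Set.Ioo (12 - 15.2 / q) (12 - 7.2 / q)) := by
  have h : gaussianReal (1.4 - 0.5 * q) (Real.toNNReal ((q / 8) ^ 2)) =
      ((gaussianReal 0 1).map (fun x => q / 8 * x)).map (fun x => x + (1.4 - 0.5 * q)) := by
    rw [gaussianReal_map_const_mul, gaussianReal_map_add_const]
    congr 1
    · ring
    · ext
      simp [Real.coe_toNNReal _ (sq_nonneg (q / 8))]
  rw [stabilityProb, h, Measure.map_map (by fun_prop) (by fun_prop),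
    Measure.map_apply (by fun_prop) measurableSet_Ioo]
  congr 1
  ext x
  have h₁ : q - 1 / 2 < q / 8 * x + (1.4 - 0.5 * q) ↔ 12 - 15.2 / q < x := by
    rw [sub_lt_comm (a := 12), lt_div_iff₀ hq]
    constructor <;> intro h <;> linarith
  have h₂ : q / 8 * x + (1.4 - 0.5 * q) < q + 1 / 2 ↔ x < 12 - 7.2 / q := by
    rw [lt_sub_comm, div_lt_iff₀ hq]
    constructor <;> intro h <;> linarith
  simp only [Set.mem_preimage, Set.mem_Ioo, Function.comp_apply, h₁, h₂]

theorem worst_case_probability_attained :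
    ∀ q ∈ Set.Icc (0.7 : ℝ) 1.1, stabilityProb 0.7 ≤ stabilityProb q := by
  rintro q ⟨hq₁, hq₂⟩
  have hq : 0 < q := by linarith
  rw [stabilityProb_eq_standard hq, stabilityProb_eq_standard (by norm_num)]
  have e₁ : (15.2 : ℝ) / q = 15.2 * q⁻¹ := div_eq_mul_inv _ _
  have e₂ : (7.2 : ℝ) / q = 7.2 * q⁻¹ := div_eq_mul_inv _ _
  have hlow : (10 / 11 : ℝ) ≤ q⁻¹ := by
    rw [le_inv_comm₀ (by norm_num) hq]; linarith
  have hhigh : q⁻¹ ≤ (10 / 7 : ℝ) := by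
    rw [inv_le_comm₀ hq (by norm_num)]; linarith
  rw [e₁, e₂]
  generalize q⁻¹ = t at hlow hhigh
  norm_num only
  rcases le_total t (10 / 9) with ht | ht
  · calc gaussianReal 0 1 (Set.Ioo (-(68 / 7)) (12 / 7))
        ≤ gaussianReal 0 1 (Set.Ioo (-4) (20 / 11)) := by
          apply gaussianReal_Ioo_le_Ioo <;> norm_num only
          have h₁ : Real.exp (-8) * 81 ≤ Real.exp (-200 / 121) := by
            have h₂ : (81 : ℝ) ≤ Real.exp 6 := by
              have h₃ : Real.exp 6 = Real.exp 2 ^ 3 := by rw [← Real.exp_nat_mul]; norm_num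
              have h₄ : Real.exp 2 = Real.exp 1 ^ 2 := by rw [← Real.exp_nat_mul]; norm_num
              rw [h₃, h₄, ← pow_mul]
              calc (81 : ℝ) ≤ 2.7 ^ (2 * 3) := by norm_num
                _ ≤ _ := by gcongr; linarith [Real.exp_one_gt_d9]
            calc Real.exp (-8) * 81 ≤ Real.exp (-8) * Real.exp 6 := by gcongr
              _ = Real.exp (-2) := by rw [← Real.exp_add]; norm_num
              _ ≤ _ := Real.exp_le_exp.2 (by norm_num)
          linarith [Real.exp_pos (-8)]
      _ = gaussianReal 0 1 (Set.Ioo (-20 / 11) 4) := by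
          rw [← gaussianReal_zero_one_Ioo_neg]; norm_num
      _ ≤ _ := measure_mono (Set.Ioo_subset_Ioo (by linarith) (by linarith))
  · apply gaussianReal_Ioo_le_Ioo
    · linarith
    · linarith
    · norm_num
    · linarith
    · have h₁ : Real.exp (-(12 - 15.2 * t) ^ 2 / 2) * 4 ≤
          Real.exp (-(12 - 7.2 * t) ^ 2 / 2) := by
        calc _ ≤ Real.exp (-(12 - 15.2 * t) ^ 2 / 2) * Real.exp 3 := by
              gcongr; linarith [Real.add_one_le_exp (3 : ℝ)]
          _ = Real.exp (-(12 - 15.2 * t) ^ 2 / 2 + 3) := (Real.exp_add _ _).symm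
          _ ≤ _ := Real.exp_le_exp.2 (by nlinarith)
      norm_num only at h₁ ⊢
      nlinarith [mul_le_mul_of_nonneg_left h₁ (sub_nonneg.2 hhigh),
        mul_nonneg (sub_nonneg.2 hhigh) (Real.exp_pos (-(12 - 76 / 5 * t) ^ 2 / 2)).le]
end
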